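/- Let A be an m×m nonnegative bisymmetric real matrix whose eigenvalues (with multiplicity) are α1 ≥ α2 ≥ ... ≥ αm admitting a unit nonnegative eigenvector u1 for α1 with Ju1 = u1, and let B be an n×n nonnegative bisymmetric real matrix whose eigenvalues (with multiplicity) are β1 ≥ β2 ≥ ... ≥ βn admitting a unit nonnegative eigenvector v1 for β1 with Jv1 = v1, and suppose α1 ≥ β1. If a and b are real numbers such that α1 − β1 ≥ a ≥ b and a + b ≤ 0, then there exists a (2n+m)×(2n+m) nonnegative bisymmetric matrix whose eigenvalues (with multiplicity) are α1 − (a+b), β1 + a, β1 + b, α2, α3, ..., αm, β2, β3, ..., βn, β2, β3, ..., βn. -/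

import Mathlib

open Matrix Polynomial BigOperators

/-- The `n × n` reverse identity (exchange) matrix `J`, with entry `1` in
positions `(i, j)` with `i + j = n - 1` (0-based) and `0` elsewhere. -/
def revId (n : ℕ) : Matrix (Fin n) (Fin n) ℝ :=
  Matrix.of fun i j => if (i : ℕ) + (j : ℕ) + 1 = n then 1 else 0

/-- A square real matrix `Q` is bisymmetric if `Qᵀ = Q` and `JQJ = Q`. -/
def IsBisymm {n : ℕ} (Q : Matrix (Fin n) (Fin n) ℝ) : Prop :=
  Qᵀ = Q ∧ revId n * Q * revId n = Q

/-- Entrywise nonnegative matrix. -/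
def MatNonneg {n : ℕ} (Q : Matrix (Fin n) (Fin n) ℝ) : Prop :=
  ∀ i j, 0 ≤ Q i j

/-- Entrywise positive matrix. -/
def MatPos {n : ℕ} (Q : Matrix (Fin n) (Fin n) ℝ) : Prop :=
  ∀ i j, 0 < Q i j

/-- `lam 0, …, lam (n-1)` are the eigenvalues of `Q` with multiplicity, i.e. the
characteristic polynomial of `Q` is `∏ i (X - lam i)`. -/
def HasEigs {n : ℕ} (Q : Matrix (Fin n) (Fin n) ℝ) (lam : Fin n → ℝ) : Prop :=
  Q.charpoly = ∏ i, (X - Polynomial.C (lam i))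

/-- The multiset `μ` is the multiset of eigenvalues (with multiplicity) of `Q`. -/
def HasEigsM {n : ℕ} (Q : Matrix (Fin n) (Fin n) ℝ) (μ : Multiset ℝ) : Prop :=
  Q.charpoly = (μ.map fun a => X - Polynomial.C a).prod

/-- `r` is the Perron root of `Q`: it is a (real) eigenvalue of `Q` which equals the
spectral radius of `Q`, i.e. every complex eigenvalue of `Q` has modulus at most `r`. -/
def IsPerronRoot {n : ℕ} (Q : Matrix (Fin n) (Fin n) ℝ) (r : ℝ) : Prop :=
  r ∈ spectrum ℝ Q ∧ ∀ μ ∈ spectrum ℂ (Q.map fun a => (a : ℂ)), ‖μ‖ ≤ r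

lemma det_glue {R ι κ : Type*} [CommRing R] [IsDomain R] [Fintype ι] [DecidableEq ι] [Fintype κ]
    [DecidableEq κ] (M : Matrix ι ι R) (W : Matrix ι κ R) (L C : Matrix κ κ R)
    (hW : Wᵀ * W = 1) (hM : M * W = W * L) (h1 : L.det ≠ 0) (h2 : (L - C).det ≠ 0) :
    (M - W * C * Wᵀ).det * L.det = M.det * (L - C).det := by
  have key : ∀ Y : Matrix κ κ R, (1 + W * (Y - 1) * Wᵀ).det = Y.det := by
    intro Y
    rw [Matrix.mul_assoc, Matrix.det_one_add_mul_comm, Matrix.mul_assoc, hW]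
    simp
  have e1 : ∀ Y : Matrix κ κ R, M * (1 + W * (Y - 1) * Wᵀ)
      = M - W * L * Wᵀ + W * (L * Y) * Wᵀ := by
    intro Y
    rw [Matrix.mul_add, ← Matrix.mul_assoc, ← Matrix.mul_assoc, hM]
    simp only [Matrix.mul_sub, Matrix.sub_mul, Matrix.mul_one, Matrix.mul_assoc]
    abel
  have e2 : ∀ Y : Matrix κ κ R, (M - W * C * Wᵀ) * (1 + W * (Y - 1) * Wᵀ)
      = M - W * L * Wᵀ + W * ((L - C) * Y) * Wᵀ := by
    intro Y
    have h3 : W * C * Wᵀ * (W * (Y - 1) * Wᵀ) = W * C * (Y - 1) * Wᵀ := by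
      calc _ = W * C * (Wᵀ * W) * (Y - 1) * Wᵀ := by simp only [Matrix.mul_assoc]
        _ = _ := by rw [hW, Matrix.mul_one]
    rw [Matrix.sub_mul, e1, Matrix.mul_add, h3]
    simp only [Matrix.mul_sub, Matrix.sub_mul, Matrix.mul_one, Matrix.mul_assoc]
    abel
  set d := L.det with hd
  set e := (L - C).det with he
  have h := congrArg Matrix.det ((e1 (e • L.adjugate)).trans (b := _) (c := (M - W * C * Wᵀ) *
      (1 + W * (d • (L - C).adjugate - 1) * Wᵀ)) (by
    rw [e2, Matrix.mul_smul L, Matrix.mul_smul (L - C), Matrix.mul_adjugate, Matrix.mul_adjugate,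
      smul_smul, smul_smul, ← hd, ← he, mul_comm d e]))
  rw [Matrix.det_mul, Matrix.det_mul, key, key, Matrix.det_smul, Matrix.det_smul] at h
  have ad1 : L.adjugate.det * d = d ^ Fintype.card κ := by
    rw [hd, mul_comm, ← Matrix.det_mul, Matrix.mul_adjugate, Matrix.det_smul]; simp
  have ad2 : (L - C).adjugate.det * e = e ^ Fintype.card κ := by
    rw [he, mul_comm, ← Matrix.det_mul, Matrix.mul_adjugate, Matrix.det_smul]; simp
  have hk : d ^ Fintype.card κ * e ^ Fintype.card κ ≠ 0 :=
    mul_ne_zero (pow_ne_zero _ h1) (pow_ne_zero _ h2)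
  apply mul_left_cancel₀ hk
  linear_combination (-d * e) * h + (M.det * e * e ^ Fintype.card κ) * ad1 -
    ((M - W * C * Wᵀ).det * d * d ^ Fintype.card κ) * ad2

lemma charmatrix_alt {τ : Type*} [Fintype τ] [DecidableEq τ] (E : Matrix τ τ ℝ) :
    E.charmatrix = (X : ℝ[X]) • (1 : Matrix τ τ ℝ[X]) - E.map Polynomial.C := by
  rw [Matrix.charmatrix, Matrix.smul_one_eq_diagonal]
  rfl

lemma charpoly_glue {ι κ : Type*} [Fintype ι] [DecidableEq ι] [Fintype κ]
    [DecidableEq κ] (D : Matrix ι ι ℝ) (W : Matrix ι κ ℝ) (L C : Matrix κ κ ℝ)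
    (hW : Wᵀ * W = 1) (hM : D * W = W * L) :
    (D + W * C * Wᵀ).charpoly * L.charpoly = D.charpoly * (L + C).charpoly := by
  have a1 : (D + W * C * Wᵀ).charmatrix = D.charmatrix -
      W.map Polynomial.C * C.map Polynomial.C * (W.map Polynomial.C)ᵀ := by
    rw [charmatrix_alt, charmatrix_alt, Matrix.map_add _ (by simp), Matrix.map_mul, Matrix.map_mul, Matrix.transpose_map]
    abel
  have a2 : (L + C).charmatrix = L.charmatrix - C.map Polynomial.C := by
    rw [charmatrix_alt, charmatrix_alt, Matrix.map_add _ (by simp)]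
    abel
  have n1 : L.charmatrix.det ≠ 0 := (Matrix.charpoly_monic L).ne_zero
  have n2 : (L + C).charmatrix.det ≠ 0 := (Matrix.charpoly_monic (L + C)).ne_zero
  rw [a2] at n2
  unfold Matrix.charpoly
  rw [a1, a2]
  refine det_glue _ _ _ _ ?_ ?_ n1 n2
  · rw [← Matrix.transpose_map, ← Matrix.map_mul, hW]
    exact Matrix.map_one _ (by simp) (by simp)
  · rw [charmatrix_alt, charmatrix_alt, Matrix.sub_mul, Matrix.mul_sub, ← Matrix.map_mul, ← Matrix.map_mul, hM]
    simp

lemma revId_conj {n : ℕ} (Q : Matrix (Fin n) (Fin n) ℝ) :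
    revId n * Q * revId n = Q.submatrix Fin.rev Fin.rev := by
  have h : ∀ i j : Fin n, revId n i j = if j = Fin.rev i then 1 else 0 := by
    intro i j
    simp only [revId, Matrix.of_apply, Fin.ext_iff, Fin.val_rev]
    congr 1
    apply propext
    omega
  have h' : ∀ i j : Fin n, revId n i j = if i = Fin.rev j then 1 else 0 := by
    intro i j
    simp only [revId, Matrix.of_apply, Fin.ext_iff, Fin.val_rev]
    congr 1
    apply propext
    omega
  ext i j
  rw [Matrix.mul_apply]
  simp only [h', mul_ite, mul_one, mul_zero, Finset.sum_ite_eq',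
    Finset.mem_univ, if_true, Matrix.submatrix_apply]
  rw [Matrix.mul_apply]
  simp only [h, ite_mul, one_mul, zero_mul, Finset.sum_ite_eq', Finset.mem_univ, if_true]

lemma revId_vec {n : ℕ} (v : Fin n → ℝ) (h : (revId n).mulVec v = v) (i : Fin n) :
    v (Fin.rev i) = v i := by
  have h2 : ∀ i j : Fin n, revId n i j = if j = Fin.rev i then 1 else 0 := by
    intro i j
    simp only [revId, Matrix.of_apply, Fin.ext_iff, Fin.val_rev]
    congr 1
    apply propext
    omega
  have h3 := congrFun h i
  simpa [Matrix.mulVec, dotProduct, h2] using h3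

/-- The matrix of glueing vectors. -/
def glueW {m n : ℕ} (u : Fin m → ℝ) (v : Fin n → ℝ) :
    Matrix (Fin n ⊕ (Fin m ⊕ Fin n)) (Fin 3) ℝ :=
  Matrix.of fun i => Sum.elim (fun i => ![v i, 0, 0])
    (Sum.elim (fun i => ![0, u i, 0]) (fun i => ![0, 0, v i])) i

/-- The block diagonal matrix. -/
def glueD {m n : ℕ} (A : Matrix (Fin m) (Fin m) ℝ) (B : Matrix (Fin n) (Fin n) ℝ) :
    Matrix (Fin n ⊕ (Fin m ⊕ Fin n)) (Fin n ⊕ (Fin m ⊕ Fin n)) ℝ :=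
  Matrix.fromBlocks B 0 0 (Matrix.fromBlocks A 0 0 B)

/-- The coupling matrix. -/
def glueC (r s : ℝ) : Matrix (Fin 3) (Fin 3) ℝ := !![0, r, s; r, 0, r; s, r, 0]

lemma glueW_orth {m n : ℕ} (u : Fin m → ℝ) (v : Fin n → ℝ) (hu : ∑ i, u i ^ 2 = 1)
    (hv : ∑ i, v i ^ 2 = 1) : (glueW u v)ᵀ * glueW u v = 1 := by
  ext i j
  fin_cases i <;> fin_cases j <;>
    simp [Matrix.mul_apply, glueW, Fintype.sum_sum_type, ← pow_two, hu, hv]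

lemma glueD_mul {m n : ℕ} (A : Matrix (Fin m) (Fin m) ℝ) (B : Matrix (Fin n) (Fin n) ℝ)
    (u : Fin m → ℝ) (v : Fin n → ℝ) (x y : ℝ) (hu : A.mulVec u = x • u)
    (hv : B.mulVec v = y • v) :
    glueD A B * glueW u v = glueW u v * Matrix.diagonal ![y, x, y] := by
  have hu' : ∀ i, ∑ j, A i j * u j = u i * x := fun i => by
    have := congrFun hu i
    simpa [Matrix.mulVec, dotProduct, mul_comm x] using this
  have hv' : ∀ i, ∑ j, B i j * v j = v i * y := fun i => by
    have := congrFun hv i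
    simpa [Matrix.mulVec, dotProduct, mul_comm y] using this
  ext i j
  rw [Matrix.mul_diagonal, Matrix.mul_apply]
  rcases i with i | i | i <;> fin_cases j <;>
    simp [glueD, glueW, Fintype.sum_sum_type, hu', hv']

/-- The glued matrix, on the sum type. -/
def glueQ {m n : ℕ} (A : Matrix (Fin m) (Fin m) ℝ) (B : Matrix (Fin n) (Fin n) ℝ)
    (u : Fin m → ℝ) (v : Fin n → ℝ) (r s : ℝ) :
    Matrix (Fin n ⊕ (Fin m ⊕ Fin n)) (Fin n ⊕ (Fin m ⊕ Fin n)) ℝ :=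
  glueD A B + glueW u v * glueC r s * (glueW u v)ᵀ

/-- Reindexing of the sum type. -/
def glueE (m n : ℕ) : Fin n ⊕ (Fin m ⊕ Fin n) ≃ Fin (n + (m + n)) :=
  (Equiv.sumCongr (Equiv.refl _) finSumFinEquiv).trans finSumFinEquiv

/-- Reversal on the sum type. -/
def glueRev {m n : ℕ} : Fin n ⊕ (Fin m ⊕ Fin n) → Fin n ⊕ (Fin m ⊕ Fin n) :=
  Sum.elim (fun i => Sum.inr (Sum.inr i.rev))
    (Sum.elim (fun i => Sum.inr (Sum.inl i.rev)) (fun i => Sum.inl i.rev))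

lemma glueE_rev {m n : ℕ} (i : Fin n ⊕ (Fin m ⊕ Fin n)) :
    (glueE m n i).rev = glueE m n (glueRev i) := by
  rcases i with i | i | i <;> ext <;> simp [glueE, glueRev, Fin.val_rev] <;> omega

lemma prod_split {n : ℕ} (hn : 0 < n) (β : Fin n → ℝ) :
    ∏ i, (X - Polynomial.C (β i)) = (X - Polynomial.C (β ⟨0, hn⟩)) *
      ((((Finset.univ.filter fun j : Fin n => 0 < (j : ℕ)).val.map β).map
        fun a => X - Polynomial.C a).prod) := by
  have h : (Finset.univ.filter fun j : Fin n => 0 < (j : ℕ)) = Finset.univ.erase ⟨0, hn⟩ := by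
    ext j
    simp [Fin.ext_iff, Nat.pos_iff_ne_zero]
  rw [h, Multiset.map_map, ← Finset.mul_prod_erase Finset.univ _ (Finset.mem_univ ⟨0, hn⟩)]
  rfl

/-- Corollary 2.4: with `A`, `B` as in the gluing lemma and `α₁ ≥ β₁`, if
`α₁ - β₁ ≥ a ≥ b` and `a + b ≤ 0`, then there is a `(2n+m) × (2n+m)` nonnegative
bisymmetric matrix with eigenvalues
`α₁ - (a+b), β₁ + a, β₁ + b, α₂, …, α_m, β₂, …, β_n, β₂, …, β_n`. -/
theorem bisymm_glue_corollary (m n : ℕ) (hm : 0 < m) (hn : 0 < n)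
    (A : Matrix (Fin m) (Fin m) ℝ) (B : Matrix (Fin n) (Fin n) ℝ)
    (α : Fin m → ℝ) (β : Fin n → ℝ) (hα : Antitone α) (hβ : Antitone β)
    (hAnn : MatNonneg A) (hAbs : IsBisymm A) (hAeig : HasEigs A α)
    (hBnn : MatNonneg B) (hBbs : IsBisymm B) (hBeig : HasEigs B β)
    (u1 : Fin m → ℝ) (hu1unit : ∑ i, u1 i ^ 2 = 1) (hu1nn : ∀ i, 0 ≤ u1 i)
    (hu1eig : A.mulVec u1 = α ⟨0, hm⟩ • u1) (hu1J : (revId m).mulVec u1 = u1)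
    (v1 : Fin n → ℝ) (hv1unit : ∑ i, v1 i ^ 2 = 1) (hv1nn : ∀ i, 0 ≤ v1 i)
    (hv1eig : B.mulVec v1 = β ⟨0, hn⟩ • v1) (hv1J : (revId n).mulVec v1 = v1)
    (hαβ : β ⟨0, hn⟩ ≤ α ⟨0, hm⟩)
    (a b : ℝ) (hab1 : a ≤ α ⟨0, hm⟩ - β ⟨0, hn⟩) (hab2 : b ≤ a) (hab3 : a + b ≤ 0) :
    ∃ Q : Matrix (Fin (n + (m + n))) (Fin (n + (m + n))) ℝ,
      MatNonneg Q ∧ IsBisymm Q ∧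
        HasEigsM Q ((α ⟨0, hm⟩ - (a + b)) ::ₘ (β ⟨0, hn⟩ + a) ::ₘ (β ⟨0, hn⟩ + b) ::ₘ
          (((Finset.univ.filter fun i : Fin m => 0 < (i : ℕ)).val.map α)
            + ((Finset.univ.filter fun j : Fin n => 0 < (j : ℕ)).val.map β)
            + ((Finset.univ.filter fun j : Fin n => 0 < (j : ℕ)).val.map β))) := by
  set x := α ⟨0, hm⟩ with hx
  set y := β ⟨0, hn⟩ with hy
  have hb : b ≤ 0 := by linarith
  obtain ⟨r, hr0, hr⟩ : ∃ r : ℝ, 0 ≤ r ∧ 2 * r ^ 2 = -(a + b) * (x - y - a) := by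
    have h0 : 0 ≤ -(a + b) * (x - y - a) / 2 := by
      have : 0 ≤ -(a + b) * (x - y - a) := mul_nonneg (by linarith) (by linarith)
      linarith
    exact ⟨Real.sqrt (-(a + b) * (x - y - a) / 2), Real.sqrt_nonneg _, by
      rw [Real.sq_sqrt h0]; ring⟩
  have hAr : ∀ i j, A i.rev j.rev = A i j := fun i j => by
    have := hAbs.2
    rw [revId_conj] at this
    exact congrFun (congrFun this i) j
  have hBr : ∀ i j, B i.rev j.rev = B i j := fun i j => by
    have := hBbs.2
    rw [revId_conj] at this
    exact congrFun (congrFun this i) j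
  have hur := revId_vec u1 hu1J
  have hvr := revId_vec v1 hv1J
  refine ⟨Matrix.reindex (glueE m n) (glueE m n) (glueQ A B u1 v1 r (-b)), ?_, ⟨?_, ?_⟩, ?_⟩
  · intro i j
    obtain ⟨i, rfl⟩ := (glueE m n).surjective i
    obtain ⟨j, rfl⟩ := (glueE m n).surjective j
    simp only [Matrix.reindex_apply, Matrix.submatrix_apply, Equiv.symm_apply_apply]
    have hb' : 0 ≤ -b := by linarith
    have hD : 0 ≤ glueD A B i j := by
      rcases i with i | i | i <;> rcases j with j | j | j <;>
        simp [glueD, hAnn _ _, hBnn _ _]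
    have hW : ∀ i k, 0 ≤ glueW u1 v1 i k := by
      intro i k
      rcases i with i | i | i <;> fin_cases k <;> simp [glueW, hu1nn, hv1nn]
    have hC : ∀ i k, 0 ≤ glueC r (-b) i k := by
      intro i k
      fin_cases i <;> fin_cases k <;> simp [glueC, hr0, hb]
    refine add_nonneg hD ?_
    rw [Matrix.mul_apply]
    refine Finset.sum_nonneg fun k _ => mul_nonneg ?_ (hW _ _)
    rw [Matrix.mul_apply]
    exact Finset.sum_nonneg fun k _ => mul_nonneg (hW _ _) (hC _ _)
  · rw [Matrix.transpose_reindex]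
    congr 1
    have hC : (glueC r (-b))ᵀ = glueC r (-b) := by
      ext i j
      fin_cases i <;> fin_cases j <;> rfl
    unfold glueQ glueD
    rw [Matrix.transpose_add, Matrix.transpose_mul, Matrix.transpose_mul, hC,
      Matrix.fromBlocks_transpose, Matrix.fromBlocks_transpose, hAbs.1, hBbs.1,
      Matrix.transpose_transpose, Matrix.mul_assoc]
    simp
  · rw [revId_conj]
    ext i j
    obtain ⟨i, rfl⟩ := (glueE m n).surjective i
    obtain ⟨j, rfl⟩ := (glueE m n).surjective j
    simp only [Matrix.reindex_apply, Matrix.submatrix_apply, glueE_rev, Equiv.symm_apply_apply]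
    rcases i with i | i | i <;> rcases j with j | j | j <;>
      simp [glueRev, glueQ, glueD, glueW, glueC, Matrix.mul_apply, Fin.sum_univ_three, hAr, hBr,
        hur, hvr]
  · unfold HasEigsM
    rw [Matrix.charpoly_reindex]
    have h := charpoly_glue (glueD A B) (glueW u1 v1) (Matrix.diagonal ![y, x, y])
      (glueC r (-b)) (glueW_orth u1 v1 hu1unit hv1unit) (glueD_mul A B u1 v1 x y hu1eig hv1eig)
    have hDc : (glueD A B).charpoly = B.charpoly * (A.charpoly * B.charpoly) := by
      unfold glueD
      rw [Matrix.charpoly_fromBlocks_zero₁₂, Matrix.charpoly_fromBlocks_zero₁₂]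
    have hL : (Matrix.diagonal ![y, x, y]).charpoly =
        (X - Polynomial.C y) * (X - Polynomial.C x) * (X - Polynomial.C y) := by
      rw [Matrix.charpoly_diagonal, Fin.prod_univ_three]
      rfl
    have hLC : (Matrix.diagonal ![y, x, y] + glueC r (-b)).charpoly =
        (X - Polynomial.C (x - (a + b))) * ((X - Polynomial.C (y + a)) *
          (X - Polynomial.C (y + b))) := by
      have hr' : 2 * (Polynomial.C r) ^ 2 = -(Polynomial.C a + Polynomial.C b) *
          (Polynomial.C x - Polynomial.C y - Polynomial.C a) := by
        have := congrArg Polynomial.C hr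
        have h2 : (Polynomial.C (2 : ℝ)) = 2 := rfl
        simpa [h2] using this
      rw [Matrix.charpoly, Matrix.det_fin_three]
      simp [glueC]
      linear_combination (-(X - Polynomial.C y - Polynomial.C b)) * hr'
    rw [hDc, hL, hLC, hAeig, hBeig, prod_split hm α, prod_split hn β] at h
    have hne : (X - Polynomial.C y) * (X - Polynomial.C x) * (X - Polynomial.C y) ≠ 0 :=
      mul_ne_zero (mul_ne_zero (X_sub_C_ne_zero _) (X_sub_C_ne_zero _)) (X_sub_C_ne_zero _)
    apply mul_right_cancel₀ hne
    change (glueQ A B u1 v1 r (-b)).charpoly * _ = _ at h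
    rw [h]
    simp only [Multiset.map_cons, Multiset.map_add, Multiset.prod_cons, Multiset.prod_add]
    ring
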